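/- Fix θ > 0, 𝐧 ∈ ℕ^q_* and an 𝐧-coloring c of [|𝐧|]. Let π be a random permutation of S_{|𝐧|} with P[π = σ] proportional to θ^{r(σ)}, where r(σ) is the number of cycles of σ including fixed points. Then for every q-colored partition A of 𝐧, P[Π(π) = A] = θ^{‖A‖} M_𝐧(A)/(θ)_{|𝐧|} = Esf_θ^𝐧(A). -/

import Mathlib

open Finset Nat
open scoped Classical

/-- `col(A) = ∑_𝐚 A(𝐚) • 𝐚`, the color count vector of a colored partition. -/
def colA {q : ℕ} (A : (Fin q → ℕ) →₀ ℕ) : Fin q → ℕ :=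
  fun j => ∑ a ∈ A.support, A a * a j

/-- `‖A‖ = ∑_𝐚 A(𝐚)`, the number of parts of a colored partition. -/
def asize {q : ℕ} (A : (Fin q → ℕ) →₀ ℕ) : ℕ := ∑ a ∈ A.support, A a

/-- The set of `q`-colored partitions of `𝐧`. -/
def CPartSet {q : ℕ} (n : Fin q → ℕ) : Set ((Fin q → ℕ) →₀ ℕ) :=
  {A | A 0 = 0 ∧ colA A = n}

/-- The multinomial coefficient `M_𝐧(A)` of a colored partition `A ⊨ 𝐧`. -/
noncomputable def Mcoef {q : ℕ} (n : Fin q → ℕ) (A : (Fin q → ℕ) →₀ ℕ) : ℝ :=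
  (∏ j, (n j)! : ℝ) *
    ∏ a ∈ A.support,
      ((Nat.multinomial Finset.univ a : ℝ) ^ A a / ((∑ j, a j : ℝ) ^ A a * (A a)!))

/-- `ε(κ) ∈ ℕ^q`: the color count of a set of elements under the coloring `c`. -/
def epsilonCount {N q : ℕ} (c : Fin N → Fin q) (s : Finset (Fin N)) : Fin q → ℕ :=
  fun j => (s.filter fun y => c y = j).card

/-- `Π(π)`: the `q`-colored partition of a permutation `π`, recording for each color count
`𝐚` the number of cycles of `π` (including fixed points) with color count `𝐚`. -/
noncomputable def Ppi {N q : ℕ} (c : Fin N → Fin q) (π : Equiv.Perm (Fin N)) :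
    (Fin q → ℕ) →₀ ℕ :=
  (∑ κ ∈ π.cycleFactorsFinset, Finsupp.single (epsilonCount c κ.support) 1) +
    ∑ y ∈ Finset.univ \ π.support, Finsupp.single (epsilonCount c {y}) 1

/-- `r(σ)`: the total number of cycles of `σ`, including fixed points. -/
def numCycles {N : ℕ} (σ : Equiv.Perm (Fin N)) : ℕ :=
  σ.cycleFactorsFinset.card + (Finset.univ \ σ.support).card

section
variable {N q : ℕ}

/-- The cycle of `x` under `σ`, as a set of points. -/
def cyclePoints (σ : Equiv.Perm (Fin N)) (x : Fin N) : Finset (Fin N) :=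
  Finset.univ.filter fun y => σ.SameCycle x y

theorem mem_cyclePoints {σ : Equiv.Perm (Fin N)} {x y : Fin N} :
    y ∈ cyclePoints σ x ↔ σ.SameCycle x y := by
  simp [cyclePoints]

theorem cyclePoints_congr {σ : Equiv.Perm (Fin N)} {x y : Fin N} (h : σ.SameCycle x y) :
    cyclePoints σ x = cyclePoints σ y := by
  ext z
  rw [mem_cyclePoints, mem_cyclePoints]
  exact ⟨h.symm.trans, h.trans⟩

theorem sum_epsilonCount (c : Fin N → Fin q) (s : Finset (Fin N)) :
    ∑ j, epsilonCount c s j = s.card :=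
  (Finset.card_eq_sum_card_fiberwise (f := c) (t := Finset.univ) (by simp)).symm

theorem epsilonCount_ne_zero (c : Fin N → Fin q) {s : Finset (Fin N)} (hs : s.Nonempty) :
    epsilonCount c s ≠ 0 := by
  intro h
  have := sum_epsilonCount c s
  simp [h] at this
  exact hs.ne_empty (Finset.card_eq_zero.mp this.symm)

theorem cyclePoints_nonempty (σ : Equiv.Perm (Fin N)) (x : Fin N) :
    (cyclePoints σ x).Nonempty :=
  ⟨x, mem_cyclePoints.mpr (Equiv.Perm.SameCycle.refl σ x)⟩

theorem cyclePoints_of_notMem_support {σ : Equiv.Perm (Fin N)} {x : Fin N}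
    (hx : x ∉ σ.support) : cyclePoints σ x = {x} := by
  ext y
  rw [mem_cyclePoints, Finset.mem_singleton]
  have hfix : Function.IsFixedPt σ x := Equiv.Perm.notMem_support.mp hx
  exact ⟨fun h => (Equiv.Perm.SameCycle.eq_of_left h hfix).symm,
    fun h => h ▸ Equiv.Perm.SameCycle.refl σ x⟩

theorem cyclePoints_of_mem_support {σ κ : Equiv.Perm (Fin N)} {x : Fin N}
    (hκ : κ ∈ σ.cycleFactorsFinset) (hx : x ∈ κ.support) : cyclePoints σ x = κ.support := by
  ext y
  rw [mem_cyclePoints]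
  conv_rhs => rw [Equiv.Perm.cycle_is_cycleOf hx hκ, Equiv.Perm.mem_support_cycleOf_iff]
  simp [Equiv.Perm.mem_cycleFactorsFinset_support_le hκ hx]

theorem Ppi_apply (c : Fin N → Fin q) (σ : Equiv.Perm (Fin N)) (a : Fin q → ℕ) :
    Ppi c σ a = (∑ κ ∈ σ.cycleFactorsFinset, if epsilonCount c κ.support = a then 1 else 0) +
      ∑ y ∈ Finset.univ \ σ.support, if epsilonCount c {y} = a then 1 else 0 := by
  simp only [Ppi, Finsupp.add_apply, Finsupp.finsetSum_apply, Finsupp.single_apply]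

theorem Ppi_zero (c : Fin N → Fin q) (σ : Equiv.Perm (Fin N)) : Ppi c σ 0 = 0 := by
  rw [Ppi_apply, Nat.add_eq_zero_iff]
  refine ⟨Finset.sum_eq_zero fun κ hκ => if_neg (epsilonCount_ne_zero c ?_),
    Finset.sum_eq_zero fun y _ => if_neg (epsilonCount_ne_zero c (Finset.singleton_nonempty y))⟩
  exact (Equiv.Perm.mem_cycleFactorsFinset_iff.mp hκ).1.nonempty_support

theorem asize_eq_degree (A : (Fin q → ℕ) →₀ ℕ) : asize A = A.degree := rfl

theorem asize_Ppi (c : Fin N → Fin q) (σ : Equiv.Perm (Fin N)) :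
    asize (Ppi c σ) = numCycles σ := by
  rw [asize_eq_degree, Ppi, map_add, map_sum, map_sum]
  simp [numCycles]

/-- The number of points whose cycle has color count `𝐚` is `|𝐚|` times the number of such
cycles. -/
theorem card_filter_epsilonCount_cyclePoints (c : Fin N → Fin q) (σ : Equiv.Perm (Fin N))
    (a : Fin q → ℕ) :
    (Finset.univ.filter fun x => epsilonCount c (cyclePoints σ x) = a).card =
      (∑ j, a j) * Ppi c σ a := by
  have key (s : Finset (Fin N)) :
      (∑ j, a j) * (if epsilonCount c s = a then 1 else 0) =
        ∑ _x ∈ s, if epsilonCount c s = a then 1 else 0 := by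
    split_ifs with h
    · rw [← h, sum_epsilonCount]; simp
    · simp
  rw [Ppi_apply, mul_add, Finset.mul_sum, Finset.mul_sum, Finset.card_filter,
    ← Finset.sum_sdiff (Finset.subset_univ σ.support), add_comm]
  congr 1
  · rw [← Finset.sum_fiberwise_of_maps_to (g := σ.cycleOf) (t := σ.cycleFactorsFinset)
      (fun x hx => Equiv.Perm.cycleOf_mem_cycleFactorsFinset_iff.mpr hx)]
    refine Finset.sum_congr rfl fun κ hκ => ?_
    have hfib : (σ.support.filter fun x => σ.cycleOf x = κ) = κ.support := by
      ext x
      rw [Finset.mem_filter]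
      constructor
      · rintro ⟨hx, rfl⟩
        simpa [Equiv.Perm.mem_support_cycleOf_iff] using hx
      · exact fun hx => ⟨Equiv.Perm.mem_cycleFactorsFinset_support_le hκ hx,
          (Equiv.Perm.cycle_is_cycleOf hx hκ).symm⟩
    rw [key, hfib]
    exact Finset.sum_congr rfl fun x hx => by rw [cyclePoints_of_mem_support hκ hx]
  · refine Finset.sum_congr rfl fun x hx => ?_
    rw [key, Finset.sum_singleton, cyclePoints_of_notMem_support (Finset.mem_sdiff.mp hx).2]

theorem sameCycle_map {α β : Type*} {σ : Equiv.Perm α} {τ : Equiv.Perm β} {f : α → β}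
    (hf : ∀ x, τ.SameCycle (f x) (f (σ x))) {x y : α} (h : σ.SameCycle x y) :
    τ.SameCycle (f x) (f y) := by
  obtain ⟨k, rfl⟩ := h
  induction k using Int.induction_on with
  | zero => exact Equiv.Perm.SameCycle.refl _ _
  | succ k ih =>
    rw [add_comm, zpow_add, zpow_one, Equiv.Perm.mul_apply]
    exact ih.trans (hf _)
  | pred k ih =>
    refine ih.trans ?_
    have := hf ((σ ^ (-(k : ℤ) - 1)) x)
    rw [← Equiv.Perm.mul_apply, ← zpow_one_add, add_sub_cancel] at this
    exact this.symm

theorem decomposeFin_symm_succ_sameCycle (σ : Equiv.Perm (Fin N)) (i : Fin N)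
    (u v : Fin (N + 1)) :
    (Equiv.Perm.decomposeFin.symm (i.succ, σ)).SameCycle u v ↔
      σ.SameCycle (Fin.cases i id u : Fin N) (Fin.cases i id v : Fin N) := by
  set τ := Equiv.Perm.decomposeFin.symm (i.succ, σ) with hτ
  have h0 : τ 0 = i.succ := Equiv.Perm.decomposeFin_symm_apply_zero _ _
  have hs (x : Fin N) : τ x.succ = if σ x = i then 0 else (σ x).succ := by
    rw [hτ, Equiv.Perm.decomposeFin_symm_apply_succ, Equiv.swap_apply_def]
    simp [Fin.succ_ne_zero]
  have hr (u : Fin (N + 1)) : τ.SameCycle u (Fin.succ (Fin.cases i id u : Fin N)) := by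
    cases u using Fin.cases with
    | zero => exact ⟨1, by simp [h0]⟩
    | succ x => exact Equiv.Perm.SameCycle.refl _ _
  constructor
  · refine fun h => sameCycle_map (f := fun u => (Fin.cases i id u : Fin N)) (fun u => ?_) h
    cases u using Fin.cases with
    | zero => simp [h0, Equiv.Perm.SameCycle.refl]
    | succ x =>
      refine ⟨1, ?_⟩
      rw [hs]
      split_ifs with h <;> simp [h]
  · refine fun h => (hr u).trans ((sameCycle_map (f := Fin.succ) (fun x => ?_) h).trans (hr v).symm)
    by_cases hx : σ x = i
    · exact ⟨2, by rw [zpow_ofNat, pow_two, Equiv.Perm.mul_apply, hs, if_pos hx, h0, hx]⟩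
    · exact ⟨1, by rw [zpow_one, hs, if_neg hx]⟩

theorem decomposeFin_symm_zero_sameCycle_succ (σ : Equiv.Perm (Fin N)) (x y : Fin N) :
    (Equiv.Perm.decomposeFin.symm (0, σ)).SameCycle x.succ y.succ ↔ σ.SameCycle x y := by
  set τ := Equiv.Perm.decomposeFin.symm (0, σ) with hτ
  have hs (x : Fin N) : τ x.succ = (σ x).succ := by
    rw [hτ, Equiv.Perm.decomposeFin_symm_apply_succ, Equiv.swap_self, Equiv.refl_apply]
  have h0 : τ 0 = 0 := Equiv.Perm.decomposeFin_symm_apply_zero _ _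
  constructor
  · refine fun h => sameCycle_map (f := fun u => (Fin.cases x id u : Fin N)) (fun u => ?_) h
    cases u using Fin.cases with
    | zero => simp [h0, Equiv.Perm.SameCycle.refl]
    | succ x => exact ⟨1, by simp [hs]⟩
  · exact sameCycle_map (f := Fin.succ) fun x => ⟨1, by simp [hs]⟩

theorem epsilonCount_eq_ite_add (c : Fin (N + 1) → Fin q) (s : Finset (Fin (N + 1))) :
    epsilonCount c s = (if 0 ∈ s then Pi.single (c 0) 1 else 0) +
      epsilonCount (c ∘ Fin.succ) (Finset.univ.filter fun x => Fin.succ x ∈ s) := by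
  ext j
  have h (p : Fin (N + 1) → Prop) [DecidablePred p] := Fin.card_filter_univ_succ p
  have hs : (s.filter fun y => c y = j) = Finset.univ.filter fun y => y ∈ s ∧ c y = j := by
    ext; simp
  rw [epsilonCount, hs, h]
  simp only [epsilonCount, Pi.add_apply, Finset.filter_filter, Function.comp_apply]
  by_cases h0 : 0 ∈ s <;> by_cases hj : c 0 = j <;> simp [h0, hj, add_comm, eq_comm]

theorem eq_of_forall_sum_mul_eq {A B : (Fin q → ℕ) →₀ ℕ} (hA : A 0 = 0) (hB : B 0 = 0)
    (h : ∀ a, (∑ j, a j) * A a = (∑ j, a j) * B a) : A = B := by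
  ext a
  by_cases ha : a = 0
  · rw [ha, hA, hB]
  · refine Nat.eq_of_mul_eq_mul_left (Nat.pos_of_ne_zero fun h0 => ha ?_) (h a)
    ext j
    exact Finset.sum_eq_zero_iff.mp h0 j (Finset.mem_univ j)

theorem sum_single_add (j : Fin q) (b : Fin q → ℕ) :
    ∑ k, (Pi.single j 1 + b : Fin q → ℕ) k = 1 + ∑ k, b k := by
  simp [Finset.sum_add_distrib]

/-- Inserting a new point as a fixed point adds a cycle with a single color. -/
theorem Ppi_decomposeFin_symm_zero (c : Fin (N + 1) → Fin q) (σ : Equiv.Perm (Fin N)) :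
    Ppi c (Equiv.Perm.decomposeFin.symm (0, σ)) =
      Ppi (c ∘ Fin.succ) σ + Finsupp.single (Pi.single (c 0) 1) 1 := by
  have hne : (Pi.single (c 0) 1 : Fin q → ℕ) ≠ 0 := by simp
  have h0 : (Equiv.Perm.decomposeFin.symm ((0 : Fin (N + 1)), σ)) 0 = 0 :=
    Equiv.Perm.decomposeFin_symm_apply_zero _ _
  refine eq_of_forall_sum_mul_eq (Ppi_zero _ _) (by simp [Ppi_zero, hne]) fun a => ?_
  have hzero : cyclePoints (Equiv.Perm.decomposeFin.symm ((0 : Fin (N + 1)), σ)) 0 = {0} :=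
    cyclePoints_of_notMem_support (Equiv.Perm.notMem_support.mpr h0)
  have hsucc (x : Fin N) :
      epsilonCount c (cyclePoints (Equiv.Perm.decomposeFin.symm ((0 : Fin (N + 1)), σ)) x.succ) =
        epsilonCount (c ∘ Fin.succ) (cyclePoints σ x) := by
    rw [epsilonCount_eq_ite_add, if_neg, zero_add]
    · simp only [mem_cyclePoints, decomposeFin_symm_zero_sameCycle_succ]
      rfl
    · intro h
      have := cyclePoints_congr (mem_cyclePoints.mp h)
      have hx : x.succ ∈ cyclePoints (Equiv.Perm.decomposeFin.symm ((0 : Fin (N + 1)), σ)) 0 :=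
        this ▸ mem_cyclePoints.mpr (Equiv.Perm.SameCycle.refl _ _)
      simp [hzero] at hx
  have hsing : epsilonCount c {0} = Pi.single (c 0) 1 := by
    rw [epsilonCount_eq_ite_add]
    ext j
    simp [epsilonCount]
  rw [← card_filter_epsilonCount_cyclePoints, Fin.card_filter_univ_succ, hzero, hsing]
  simp only [hsucc, Function.comp_def, Finsupp.add_apply, mul_add,
    ← card_filter_epsilonCount_cyclePoints]
  by_cases ha : Pi.single (c 0) 1 = a
  · subst ha; simp
  · simp [ha]

theorem card_filter_of_forall_iff {α : Type*} {s : Finset α} {p : α → Prop} [DecidablePred p]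
    {P : Prop} [Decidable P] (h : ∀ x ∈ s, p x ↔ P) :
    (s.filter p).card = if P then s.card else 0 := by
  split_ifs with hP
  · rw [Finset.filter_true_of_mem fun x hx => (h x hx).mpr hP]
  · rw [Finset.filter_false_of_mem fun x hx hpx => hP ((h x hx).mp hpx), Finset.card_empty]

/-- Inserting a new point before `i` adds its color to the color count of the cycle of `i`. -/
theorem Ppi_decomposeFin_symm_succ (c : Fin (N + 1) → Fin q) (σ : Equiv.Perm (Fin N))
    (i : Fin N) :
    Ppi c (Equiv.Perm.decomposeFin.symm (i.succ, σ)) +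
        Finsupp.single (epsilonCount (c ∘ Fin.succ) (cyclePoints σ i)) 1 =
      Ppi (c ∘ Fin.succ) σ + Finsupp.single
        (Pi.single (c 0) 1 + epsilonCount (c ∘ Fin.succ) (cyclePoints σ i)) 1 := by
  set τ := Equiv.Perm.decomposeFin.symm (i.succ, σ) with hτ
  set b := epsilonCount (c ∘ Fin.succ) (cyclePoints σ i) with hb
  have hb0 : b ≠ 0 := epsilonCount_ne_zero _ (cyclePoints_nonempty σ i)
  refine eq_of_forall_sum_mul_eq (by simp [Ppi_zero, hb0])
    (by simp [Ppi_zero]) fun a => ?_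
  have hcyc (u : Fin (N + 1)) : epsilonCount c (cyclePoints τ u) =
      (if σ.SameCycle (Fin.cases i id u : Fin N) i then Pi.single (c 0) 1 else 0) +
        epsilonCount (c ∘ Fin.succ) (cyclePoints σ (Fin.cases i id u : Fin N)) := by
    rw [epsilonCount_eq_ite_add]
    simp only [mem_cyclePoints, hτ, decomposeFin_symm_succ_sameCycle]
    rfl
  have hzero : epsilonCount c (cyclePoints τ 0) = Pi.single (c 0) 1 + b :=
    (hcyc 0).trans (by rw [Fin.cases_zero, if_pos (Equiv.Perm.SameCycle.refl σ i)])
  have hsucc (x : Fin N) : epsilonCount c (cyclePoints τ x.succ) =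
      (if σ.SameCycle x i then Pi.single (c 0) 1 else 0) +
        epsilonCount (c ∘ Fin.succ) (cyclePoints σ x) := hcyc x.succ
  have hsplit (p : Fin N → Prop) [DecidablePred p] : (Finset.univ.filter p).card =
      ((cyclePoints σ i).filter p).card +
        (Finset.univ.filter fun x => ¬ σ.SameCycle x i ∧ p x).card := by
    rw [← Finset.card_filter_add_card_filter_not (s := Finset.univ.filter p)
      (fun x => σ.SameCycle x i)]
    congr 2 <;> ext x <;>
      simp [mem_cyclePoints, and_comm, Equiv.Perm.sameCycle_comm]
  have hsum : (cyclePoints σ i).card = ∑ j, b j := (sum_epsilonCount _ _).symm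
  have hin (x : Fin N) (hx : x ∈ cyclePoints σ i) :
      epsilonCount (c ∘ Fin.succ) (cyclePoints σ x) = b := by
    rw [hb, cyclePoints_congr (mem_cyclePoints.mp hx)]
  have h1 : (∑ j, a j) * Ppi c τ a = (if Pi.single (c 0) 1 + b = a then 1 else 0) +
      ((if Pi.single (c 0) 1 + b = a then ∑ j, b j else 0) +
        (Finset.univ.filter fun x => ¬ σ.SameCycle x i ∧
          epsilonCount (c ∘ Fin.succ) (cyclePoints σ x) = a).card) := by
    rw [← card_filter_epsilonCount_cyclePoints, Fin.card_filter_univ_succ, hzero]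
    simp only [hsucc]
    rw [hsplit, card_filter_of_forall_iff (P := Pi.single (c 0) 1 + b = a), hsum]
    · have hout : (Finset.univ.filter fun x => ¬ σ.SameCycle x i ∧
          (if σ.SameCycle x i then Pi.single (c 0) 1 else 0) +
            epsilonCount (c ∘ Fin.succ) (cyclePoints σ x) = a) =
          Finset.univ.filter fun x => ¬ σ.SameCycle x i ∧
            epsilonCount (c ∘ Fin.succ) (cyclePoints σ x) = a :=
        Finset.filter_congr fun x _ => and_congr_right fun hx => by rw [if_neg hx, zero_add]
      rw [hout]
      split_ifs <;> omega
    · intro x hx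
      rw [if_pos (mem_cyclePoints.mp hx).symm, hin x hx]
  have h2 : (∑ j, a j) * Ppi (c ∘ Fin.succ) σ a = (if b = a then ∑ j, b j else 0) +
      (Finset.univ.filter fun x => ¬ σ.SameCycle x i ∧
        epsilonCount (c ∘ Fin.succ) (cyclePoints σ x) = a).card := by
    rw [← card_filter_epsilonCount_cyclePoints, hsplit,
      card_filter_of_forall_iff (P := b = a) fun x hx => by rw [hin x hx], hsum]
  have h3 := sum_single_add (c 0) b
  simp only [Finsupp.add_apply, mul_add, h1, h2, Finsupp.single_apply]
  have h4 : b = a → ∑ j, b j = ∑ j, a j := fun h => by rw [h]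
  have h5 : Pi.single (c 0) 1 + b = a → ∑ j, a j = 1 + ∑ j, b j := fun h => by rw [← h, h3]
  split_ifs with h6 h7 h7
  · have := h4 h7
    have := h5 h6
    omega
  · have := h5 h6
    omega
  · have := h4 h7
    omega
  · omega

theorem asize_add (A B : (Fin q → ℕ) →₀ ℕ) : asize (A + B) = asize A + asize B :=
  map_add Finsupp.degree A B

theorem asize_single (a : Fin q → ℕ) (k : ℕ) : asize (Finsupp.single a k) = k :=
  Finsupp.degree_single a k

theorem numCycles_decomposeFin_symm_zero (σ : Equiv.Perm (Fin N)) :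
    numCycles (Equiv.Perm.decomposeFin.symm (0, σ)) = numCycles σ + 1 := by
  have h := congrArg asize (Ppi_decomposeFin_symm_zero (fun _ => (0 : Fin 1)) σ)
  simpa only [asize_add, asize_single, asize_Ppi] using h

theorem numCycles_decomposeFin_symm_succ (σ : Equiv.Perm (Fin N)) (i : Fin N) :
    numCycles (Equiv.Perm.decomposeFin.symm (i.succ, σ)) = numCycles σ := by
  have h := congrArg asize (Ppi_decomposeFin_symm_succ (fun _ => (0 : Fin 1)) σ i)
  simpa only [asize_add, asize_single, asize_Ppi, Nat.add_right_cancel_iff] using h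

theorem sum_perm_succ {M : Type*} [AddCommMonoid M] (f : Equiv.Perm (Fin (N + 1)) → M) :
    ∑ σ, f σ = ∑ σ, (f (Equiv.Perm.decomposeFin.symm (0, σ)) +
      ∑ i : Fin N, f (Equiv.Perm.decomposeFin.symm (i.succ, σ))) := by
  rw [← Equiv.sum_comp Equiv.Perm.decomposeFin.symm, Fintype.sum_prod_type, Finset.sum_comm]
  exact Finset.sum_congr rfl fun σ _ => Fin.sum_univ_succ _

theorem sum_pow_numCycles (θ : ℝ) (N : ℕ) :
    ∑ σ : Equiv.Perm (Fin N), θ ^ numCycles σ = (ascPochhammer ℝ N).eval θ := by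
  induction N with
  | zero => simp [numCycles]
  | succ N ih =>
    rw [sum_perm_succ, ascPochhammer_succ_right, Polynomial.eval_mul, ← ih, Finset.sum_mul]
    refine Finset.sum_congr rfl fun σ _ => ?_
    simp only [numCycles_decomposeFin_symm_zero, numCycles_decomposeFin_symm_succ, pow_succ]
    simp
    ring

theorem colA_add (A B : (Fin q → ℕ) →₀ ℕ) : colA (A + B) = colA A + colA B := by
  ext j
  exact Finsupp.sum_add_index' (h := fun (a : Fin q → ℕ) k => k * a j) (by simp) (by simp [add_mul])

theorem colA_single (a : Fin q → ℕ) : colA (Finsupp.single a 1) = a := by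
  ext j
  exact (Finsupp.sum_single_index (h := fun (a : Fin q → ℕ) k => k * a j) (by simp)).trans
    (one_mul _)

/-- The weight `(|𝐚| - 1)! / 𝐚!` of a cycle with color count `𝐚`. -/
noncomputable def cycleWeight (a : Fin q → ℕ) : ℝ :=
  (Nat.multinomial Finset.univ a : ℝ) / (∑ j, a j : ℝ)

/-- The exponential weight of a multiset of cycles with color counts recorded by `A`. -/
noncomputable def partitionWeight (A : (Fin q → ℕ) →₀ ℕ) : ℝ :=
  A.prod fun a k => cycleWeight a ^ k / (k ! : ℝ)

theorem Mcoef_eq (n : Fin q → ℕ) (A : (Fin q → ℕ) →₀ ℕ) :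
    Mcoef n A = (∏ j, (n j)! : ℝ) * partitionWeight A := by
  simp only [Mcoef, partitionWeight, Finsupp.prod, cycleWeight, div_pow, div_div]

theorem partitionWeight_add_single (A : (Fin q → ℕ) →₀ ℕ) (a : Fin q → ℕ) :
    partitionWeight (A + Finsupp.single a 1) * (A a + 1) = partitionWeight A * cycleWeight a := by
  have h0 (b : Fin q → ℕ) : cycleWeight b ^ 0 / ((0 ! : ℕ) : ℝ) = 1 := by simp
  have hext (B : (Fin q → ℕ) →₀ ℕ) (hB : B.support ⊆ insert a A.support) :
      partitionWeight B = ∏ b ∈ insert a A.support, cycleWeight b ^ B b / ((B b)! : ℝ) :=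
    Finsupp.prod_of_support_subset B hB _ fun b _ => h0 b
  have hsub : (A + Finsupp.single a 1).support ⊆ insert a A.support := by
    intro b hb
    by_contra h
    rw [Finset.mem_insert, not_or, Finsupp.notMem_support_iff] at h
    simp [h.2, Ne.symm h.1] at hb
  rw [hext _ hsub, hext A (Finset.subset_insert _ _),
    ← Finset.mul_prod_erase _ _ (Finset.mem_insert_self a _),
    ← Finset.mul_prod_erase _ (fun b => cycleWeight b ^ A b / ((A b)! : ℝ))
      (Finset.mem_insert_self a _)]
  rw [Finset.prod_congr rfl fun b hb => by
    rw [Finsupp.add_apply, Finsupp.single_eq_of_ne (Finset.ne_of_mem_erase hb), add_zero]]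
  have : ((A a)! : ℝ) ≠ 0 := by positivity
  have : (A a + 1 : ℝ) ≠ 0 := by positivity
  rw [Finsupp.add_apply, Finsupp.single_eq_same, Nat.factorial_succ]
  push_cast
  field_simp
  ring

theorem prod_factorial_single_add (j : Fin q) (b : Fin q → ℕ) :
    ∏ k, ((Pi.single j 1 + b : Fin q → ℕ) k)! = (b j + 1) * ∏ k, (b k)! := by
  rw [← Finset.mul_prod_erase _ _ (Finset.mem_univ j),
    ← Finset.mul_prod_erase _ (fun k => (b k)!) (Finset.mem_univ j),
    Finset.prod_congr rfl fun k hk => by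
      rw [Pi.add_apply, Pi.single_eq_of_ne (Finset.ne_of_mem_erase hk), zero_add]]
  rw [Pi.add_apply, Pi.single_eq_same, add_comm 1, Nat.factorial_succ, mul_assoc]

theorem cycleWeight_single (j : Fin q) : cycleWeight (Pi.single j 1) = 1 := by
  have h := Nat.multinomial_spec Finset.univ (Pi.single j 1 : Fin q → ℕ)
  have h1 := prod_factorial_single_add j 0
  have hs : ∑ k, (Pi.single j 1 : Fin q → ℕ) k = 1 := by simp
  simp only [add_zero] at h1
  rw [h1, hs] at h
  simp at h
  have hs' : ∑ k, (((Pi.single j 1 : Fin q → ℕ) k : ℕ) : ℝ) = 1 := by exact_mod_cast hs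
  rw [cycleWeight, hs', h]
  simp

theorem cycleWeight_single_add (j : Fin q) {b : Fin q → ℕ} (hb : b ≠ 0) :
    cycleWeight (Pi.single j 1 + b) * (b j + 1) = cycleWeight b * ∑ k, (b k : ℝ) := by
  have h := Nat.multinomial_spec Finset.univ (Pi.single j 1 + b)
  have hb' := Nat.multinomial_spec Finset.univ b
  rw [prod_factorial_single_add, sum_single_add, add_comm 1, Nat.factorial_succ, ← hb'] at h
  have hpos : 0 < ∏ k, (b k)! := Finset.prod_pos fun k _ => Nat.factorial_pos _
  have key : (b j + 1) * Nat.multinomial Finset.univ (Pi.single j 1 + b) =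
      (∑ k, b k + 1) * Nat.multinomial Finset.univ b :=
    Nat.eq_of_mul_eq_mul_left hpos (by linarith)
  have hsum : ∑ k, b k ≠ 0 := fun h0 => hb <| funext fun k =>
    Finset.sum_eq_zero_iff.mp h0 k (Finset.mem_univ k)
  have hsumR : ∑ k, (b k : ℝ) ≠ 0 := by exact_mod_cast hsum
  have hs : ∑ k, (((Pi.single j 1 + b : Fin q → ℕ) k : ℕ) : ℝ) = ∑ k, (b k : ℝ) + 1 := by
    have := sum_single_add j b
    rw [add_comm 1] at this
    exact_mod_cast this
  have hpos' : (∑ k, (b k : ℝ) + 1) ≠ 0 := by positivity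
  have keyR : ((b j : ℝ) + 1) * Nat.multinomial Finset.univ (Pi.single j 1 + b) =
      (∑ k, (b k : ℝ) + 1) * Nat.multinomial Finset.univ b := by exact_mod_cast key
  rw [cycleWeight, cycleWeight, hs, div_mul_cancel₀ _ hsumR, div_mul_eq_mul_div,
    div_eq_iff hpos']
  linarith

theorem epsilonCount_univ_succ (c : Fin (N + 1) → Fin q) :
    epsilonCount c Finset.univ =
      Pi.single (c 0) 1 + epsilonCount (c ∘ Fin.succ) Finset.univ := by
  rw [epsilonCount_eq_ite_add, if_pos (Finset.mem_univ _)]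
  simp

theorem sum_ite_eq_and {α : Type*} [DecidableEq α] (s : Finset α) (x : α) (R : α → Prop)
    [DecidablePred R] (h : R x → x ∈ s) :
    (∑ a ∈ s, if x = a ∧ R a then (1 : ℝ) else 0) = if R x then 1 else 0 := by
  simp only [ite_and]
  rw [Finset.sum_ite_eq]
  split_ifs with h1 h2 h2
  · rfl
  · rfl
  · exact absurd (h h2) h1
  · rfl

/-- The contribution to the count of permutations with colored partition `A` of those in which
the point `0` lies in a cycle with color count `𝐚`. -/
theorem sum_insertions (c : Fin (N + 1) → Fin q) {A : (Fin q → ℕ) →₀ ℕ} (h0 : A 0 = 0)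
    (hA : colA A = epsilonCount c Finset.univ)
    (ih : ∀ B : (Fin q → ℕ) →₀ ℕ, B 0 = 0 →
      colA B = epsilonCount (c ∘ Fin.succ) Finset.univ →
      (∑ σ : Equiv.Perm (Fin N), if Ppi (c ∘ Fin.succ) σ = B then (1 : ℝ) else 0) =
        Mcoef (epsilonCount (c ∘ Fin.succ) Finset.univ) B)
    {a : Fin q → ℕ} (ha : a ∈ A.support) :
    (∑ σ : Equiv.Perm (Fin N),
      ((if Pi.single (c 0) 1 = a ∧ Ppi (c ∘ Fin.succ) σ + Finsupp.single a 1 = A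
          then (1 : ℝ) else 0) +
        ∑ i : Fin N,
          if Pi.single (c 0) 1 + epsilonCount (c ∘ Fin.succ) (cyclePoints σ i) = a ∧
            Ppi (c ∘ Fin.succ) σ + Finsupp.single a 1 =
              A + Finsupp.single (epsilonCount (c ∘ Fin.succ) (cyclePoints σ i)) 1
          then (1 : ℝ) else 0)) =
      (∏ j, ((epsilonCount (c ∘ Fin.succ) Finset.univ j)! : ℝ)) * partitionWeight A *
        (A a * a (c 0) : ℕ) := by
  set e : Fin q → ℕ := Pi.single (c 0) 1 with he
  set c' := c ∘ Fin.succ with hc'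
  have hej : e (c 0) = 1 := Pi.single_eq_same _ _
  have hb0 (σ : Equiv.Perm (Fin N)) (i : Fin N) : epsilonCount c' (cyclePoints σ i) ≠ 0 :=
    epsilonCount_ne_zero _ (cyclePoints_nonempty σ i)
  by_cases haj : a (c 0) = 0
  · have h1 (b : Fin q → ℕ) : e + b ≠ a := fun h => by
      have := congrFun h (c 0)
      rw [Pi.add_apply, hej, haj] at this
      omega
    have h2 : e ≠ a := fun h => h1 0 (by rw [add_zero, h])
    simp [h1, h2, haj]
  obtain ⟨C, rfl⟩ : ∃ C, A = C + Finsupp.single a 1 := by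
    refine ⟨A - Finsupp.single a 1, (tsub_add_cancel_of_le ?_).symm⟩
    rw [Finsupp.single_le_iff]
    exact Nat.one_le_iff_ne_zero.mpr (Finsupp.mem_support_iff.mp ha)
  have hF := partitionWeight_add_single C a
  have hC0 : C 0 = 0 := (Nat.add_eq_zero_iff.mp h0).1
  rw [colA_add, colA_single, epsilonCount_univ_succ, ← he, ← hc'] at hA
  obtain ⟨b, rfl⟩ : ∃ b, a = e + b := by
    refine ⟨a - e, (add_tsub_cancel_of_le fun k => ?_).symm⟩
    by_cases hk : k = c 0
    · subst hk
      rw [hej]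
      exact Nat.one_le_iff_ne_zero.mpr haj
    · simp [he, hk]
  have hAa : ((C + Finsupp.single (e + b) 1 : (Fin q → ℕ) →₀ ℕ) (e + b) : ℝ) = C (e + b) + 1 := by
    simp
  rw [Nat.cast_mul, hAa]
  by_cases hb : b = 0
  · subst hb
    simp only [add_zero, add_eq_left, hb0, false_and, if_false, Finset.sum_const_zero, true_and,
      add_left_inj] at hF hA hAa ⊢
    rw [ih C hC0 (add_right_cancel (hA.trans (add_comm _ _))), Mcoef_eq, hej]
    rw [he, cycleWeight_single, mul_one] at hF
    rw [he, ← hF]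
    push_cast
    ring
  · have hne : e ≠ e + b := fun h => hb (by simpa using h)
    have hbe : b ≠ e + b := fun h => by
      have := congrFun h (c 0)
      rw [Pi.add_apply, hej] at this
      omega
    have hterm (σ : Equiv.Perm (Fin N)) : (∑ i : Fin N,
          if e + epsilonCount c' (cyclePoints σ i) = e + b ∧
            Ppi c' σ + Finsupp.single (e + b) 1 = C + Finsupp.single (e + b) 1 +
              Finsupp.single (epsilonCount c' (cyclePoints σ i)) 1
          then (1 : ℝ) else 0) =
        (if Ppi c' σ = C + Finsupp.single b 1 then 1 else 0) *
          ((∑ j, (b j : ℝ)) * (C b + 1)) := by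
      have hiff (i : Fin N) : (e + epsilonCount c' (cyclePoints σ i) = e + b ∧
            Ppi c' σ + Finsupp.single (e + b) 1 = C + Finsupp.single (e + b) 1 +
              Finsupp.single (epsilonCount c' (cyclePoints σ i)) 1) ↔
          Ppi c' σ = C + Finsupp.single b 1 ∧ epsilonCount c' (cyclePoints σ i) = b := by
        rw [add_right_inj, and_comm]
        refine and_congr_left fun h => ?_
        rw [h, add_right_comm, add_left_inj]
      simp only [hiff]
      by_cases hP : Ppi c' σ = C + Finsupp.single b 1
      · simp only [hP, true_and, if_true, one_mul]
        rw [Finset.sum_boole, card_filter_epsilonCount_cyclePoints, hP]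
        simp
      · simp [hP]
    have hcol : colA (C + Finsupp.single b 1) = epsilonCount c' Finset.univ := by
      rw [colA_add, colA_single]
      refine add_left_cancel (a := e) ?_
      rw [← hA]
      abel
    simp only [hne, false_and, if_false, zero_add, hterm]
    rw [← Finset.sum_mul, ih _ (by simp [hC0, hb]) hcol, Mcoef_eq, Pi.add_apply, hej]
    have hFb := partitionWeight_add_single C b
    have hw := cycleWeight_single_add (c 0) hb
    rw [← he] at hw
    push_cast
    linear_combination (∏ j, ((epsilonCount c' Finset.univ j)! : ℝ)) *
      ((∑ j, (b j : ℝ)) * hFb - (1 + b (c 0) : ℝ) * hF - partitionWeight C * hw)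

/-- The number of permutations with colored partition `A` is `M_𝐧(A)`. -/
theorem sum_ite_Ppi_eq (c : Fin N → Fin q) (A : (Fin q → ℕ) →₀ ℕ) (h0 : A 0 = 0)
    (hA : colA A = epsilonCount c Finset.univ) :
    (∑ σ : Equiv.Perm (Fin N), if Ppi c σ = A then (1 : ℝ) else 0) =
      Mcoef (epsilonCount c Finset.univ) A := by
  induction N generalizing A with
  | zero =>
    have hε : epsilonCount c Finset.univ = 0 := by
      ext j
      simp [epsilonCount]
    obtain rfl : A = 0 := by
      by_contra hne
      obtain ⟨a, ha⟩ := Finsupp.support_nonempty_iff.mpr hne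
      refine Finsupp.mem_support_iff.mp ha ?_
      have ha0 : a = 0 := funext fun j => by
        have := Finset.sum_eq_zero_iff.mp (congrFun (hA.trans hε) j) a ha
        exact (Nat.mul_eq_zero.mp this).resolve_left (Finsupp.mem_support_iff.mp ha)
      rw [ha0, h0]
    rw [hε]
    have hP (σ : Equiv.Perm (Fin 0)) : Ppi c σ = 0 := by
      rw [Subsingleton.elim σ 1]
      simp [Ppi]
    simp [Mcoef, hP]
  | succ N ih =>
    have hstep (σ : Equiv.Perm (Fin N)) :
        (if Ppi c (Equiv.Perm.decomposeFin.symm (0, σ)) = A then (1 : ℝ) else 0) +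
          ∑ i : Fin N,
            (if Ppi c (Equiv.Perm.decomposeFin.symm (i.succ, σ)) = A then (1 : ℝ) else 0) =
        ∑ a ∈ A.support,
          ((if Pi.single (c 0) 1 = a ∧ Ppi (c ∘ Fin.succ) σ + Finsupp.single a 1 = A
              then (1 : ℝ) else 0) +
            ∑ i : Fin N,
              if Pi.single (c 0) 1 + epsilonCount (c ∘ Fin.succ) (cyclePoints σ i) = a ∧
                Ppi (c ∘ Fin.succ) σ + Finsupp.single a 1 =
                  A + Finsupp.single (epsilonCount (c ∘ Fin.succ) (cyclePoints σ i)) 1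
              then (1 : ℝ) else 0) := by
      rw [Finset.sum_add_distrib, Finset.sum_comm,
        sum_ite_eq_and _ _ fun a => Ppi (c ∘ Fin.succ) σ + Finsupp.single a 1 = A]
      · congr 1
        · rw [Ppi_decomposeFin_symm_zero]
        · refine Finset.sum_congr rfl fun i _ => ?_
          rw [sum_ite_eq_and _ _ fun a => Ppi (c ∘ Fin.succ) σ + Finsupp.single a 1 =
            A + Finsupp.single (epsilonCount (c ∘ Fin.succ) (cyclePoints σ i)) 1]
          · simp only [← Ppi_decomposeFin_symm_succ, add_left_inj]
          · intro h
            have hne : epsilonCount (c ∘ Fin.succ) (cyclePoints σ i) ≠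
                Pi.single (c 0) 1 + epsilonCount (c ∘ Fin.succ) (cyclePoints σ i) := fun h => by
              have := congrFun h (c 0)
              rw [Pi.add_apply, Pi.single_eq_same] at this
              omega
            have := DFunLike.congr_fun h
              (Pi.single (c 0) 1 + epsilonCount (c ∘ Fin.succ) (cyclePoints σ i))
            rw [Finsupp.add_apply, Finsupp.add_apply, Finsupp.single_eq_same,
              Finsupp.single_eq_of_ne hne.symm] at this
            rw [Finsupp.mem_support_iff]
            omega
      · intro h
        rw [← h, Finsupp.mem_support_iff]
        simp
    rw [sum_perm_succ, Finset.sum_congr rfl fun σ _ => hstep σ, Finset.sum_comm,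
      Finset.sum_congr rfl fun a ha => sum_insertions c h0 hA (ih (c ∘ Fin.succ)) ha,
      ← Finset.mul_sum, ← Nat.cast_sum]
    have hcol : ∑ a ∈ A.support, A a * a (c 0) =
        epsilonCount (c ∘ Fin.succ) Finset.univ (c 0) + 1 := by
      have := congrFun hA (c 0)
      rw [epsilonCount_univ_succ, Pi.add_apply, Pi.single_eq_same] at this
      exact this.trans (add_comm _ _)
    have hfac := prod_factorial_single_add (c 0) (epsilonCount (c ∘ Fin.succ) Finset.univ)
    rw [← epsilonCount_univ_succ] at hfac
    rw [Mcoef_eq, hcol, ← Nat.cast_prod, ← Nat.cast_prod, hfac]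
    push_cast
    ring

end


/-- **The polychromatic ESF counts θ-biased colored permutations.** If a random
`π ∈ S_{|𝐧|}` is chosen with probability proportional to `θ^{r(π)}`, then for every
colored partition `A ⊨ 𝐧`, `P[Π(π) = A] = θ^{‖A‖} M_𝐧(A)/(θ)_{|𝐧|} = Esf_θ^𝐧(A)`. -/
theorem theta_biased_coloring (q : ℕ) (nv : Fin q → ℕ) (hnv : nv ≠ 0)
    (c : Fin (∑ j, nv j) → Fin q)
    (hc : ∀ j, (Finset.univ.filter fun i => c i = j).card = nv j)
    (θ : ℝ) (hθ : 0 < θ) (A : (Fin q → ℕ) →₀ ℕ) (hA : A ∈ CPartSet nv) :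
    (∑ σ : Equiv.Perm (Fin (∑ j, nv j)), if Ppi c σ = A then θ ^ numCycles σ else 0) /
        (∑ σ : Equiv.Perm (Fin (∑ j, nv j)), θ ^ numCycles σ) =
      θ ^ asize A * Mcoef nv A / (ascPochhammer ℝ (∑ j, nv j)).eval θ := by
  have hε : epsilonCount c Finset.univ = nv := funext hc
  have hnum (σ : Equiv.Perm (Fin (∑ j, nv j))) :
      (if Ppi c σ = A then θ ^ numCycles σ else 0) =
        θ ^ asize A * if Ppi c σ = A then 1 else 0 := by
    split_ifs with h
    · rw [← h, asize_Ppi, mul_one]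
    · rw [mul_zero]
  rw [sum_pow_numCycles, Finset.sum_congr rfl fun σ _ => hnum σ, ← Finset.mul_sum,
    sum_ite_Ppi_eq c A hA.1 (hA.2.trans hε.symm), hε]
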